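/- Assume that for each n the interpolation nodes obey the density function w, and that each external field φ_n is twice continuously differentiable on [-1,1] with φ_n''(x) ≥ M for all n and all x ∈ [-1,1], where M is a constant independent of n. Then for all sufficiently large n and each index i ∈ {1,...,n} there exists a unique point ζ ∈ (x_{i-1}^{(n)}, x_i^{(n)}) such that U_n'(ζ) = 0. -/

import Mathlib

open Filter Finset Set

noncomputable def discretePotential (X : ℕ → ℕ → ℝ) (φ : ℕ → ℝ → ℝ) (n : ℕ) (x : ℝ) : ℝ :=
  (1 / (n + 1 : ℝ)) * ∑ i ∈ Finset.range (n + 1), Real.log (1 / |x - X n i|) + φ n x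

noncomputable def continuousPotential (w : ℝ → ℝ) (φ : ℝ → ℝ) (x : ℝ) : ℝ :=
  (∫ t in (-1 : ℝ)..1, Real.log (1 / |x - t|) * w t) + φ x

noncomputable def baryWeight (X : ℕ → ℕ → ℝ) (φ : ℕ → ℝ → ℝ) (n i : ℕ) : ℝ :=
  Real.exp ((n + 1 : ℝ) * φ n (X n i)) / ∏ k ∈ (Finset.range (n + 1)).erase i, |X n i - X n k|

noncomputable def lagrangeBasis (X : ℕ → ℕ → ℝ) (φ : ℕ → ℝ → ℝ) (n k : ℕ) (x : ℝ) : ℝ :=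
  ((∏ i ∈ (Finset.range (n + 1)).erase k, (x - X n i)) /
      (∏ i ∈ (Finset.range (n + 1)).erase k, (X n k - X n i))) *
    Real.exp ((n + 1 : ℝ) * (φ n (X n k) - φ n x))

noncomputable def lebesgueFun (X : ℕ → ℕ → ℝ) (φ : ℕ → ℝ → ℝ) (n : ℕ) (x : ℝ) : ℝ :=
  ∑ k ∈ Finset.range (n + 1), |lagrangeBasis X φ n k x|

def ObeysDensity (X : ℕ → ℕ → ℝ) (w : ℝ → ℝ) : Prop :=
  ∀ a b : ℝ, -1 ≤ a → a ≤ b → b ≤ 1 →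
    Filter.Tendsto
      (fun n : ℕ =>
        (((Finset.range (n + 1)).filter fun i => a ≤ X n i ∧ X n i ≤ b).card : ℝ) / (n + 1))
      Filter.atTop (nhds (∫ t in a..b, w t))

theorem hasDerivAt_discretePotential {X : ℕ → ℕ → ℝ} {φ φ' : ℕ → ℝ → ℝ} {n : ℕ} {z : ℝ}
    (hz : ∀ i ∈ Finset.range (n + 1), z ≠ X n i) (hφ : HasDerivAt (φ n) (φ' n z) z) :
    HasDerivAt (discretePotential X φ n)
      ((1 / (n + 1 : ℝ)) * ∑ i ∈ Finset.range (n + 1), -(z - X n i)⁻¹ + φ' n z) z := by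
  have hfun : discretePotential X φ n = fun x =>
      (1 / (n + 1 : ℝ)) * ∑ i ∈ Finset.range (n + 1), -Real.log (x - X n i) + φ n x := by
    ext x
    simp [discretePotential, Real.log_abs]
  rw [hfun]
  refine ((HasDerivAt.fun_sum fun i hi => ?_).const_mul _).add hφ
  have := (((hasDerivAt_id z).sub_const (X n i)).log (sub_ne_zero.2 (hz i hi))).neg
  simpa [one_div, Pi.neg_def] using this

theorem hasDerivAt_sum_neg_inv_sub {ι : Type*} (s : Finset ι) (a : ι → ℝ) (c : ℝ)
    {ψ : ℝ → ℝ} {ψ' z : ℝ} (hz : ∀ i ∈ s, z ≠ a i) (hψ : HasDerivAt ψ ψ' z) :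
    HasDerivAt (fun x => c * ∑ i ∈ s, -(x - a i)⁻¹ + ψ x)
      (c * ∑ i ∈ s, ((z - a i) ^ 2)⁻¹ + ψ') z := by
  refine ((HasDerivAt.fun_sum fun i hi => ?_).const_mul _).add hψ
  have := (((hasDerivAt_id z).sub_const (a i)).inv (sub_ne_zero.2 (hz i hi))).neg
  simpa [neg_div, one_div, Pi.neg_def, Pi.inv_def] using this

theorem tendsto_sum_neg_inv_sub {ι : Type*} [DecidableEq ι] {s : Finset ι} {a : ι → ℝ} {c : ℝ}
    {ψ : ℝ → ℝ} {k : ι} {l : Filter ℝ} {m : Filter ℝ} (hk : k ∈ s)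
    (hne : ∀ i ∈ s, i ≠ k → a k ≠ a i) (hψ : ContinuousAt ψ (a k)) (hl : l ≤ nhds (a k))
    (hm : ∀ C : ℝ, ∀ f g : ℝ → ℝ, Tendsto f l m → Tendsto g l (nhds C) →
      Tendsto (fun x => f x + g x) l m)
    (hlim : Tendsto (fun x => c * -(x - a k)⁻¹) l m) :
    Tendsto (fun x => c * ∑ i ∈ s, -(x - a i)⁻¹ + ψ x) l m := by
  have hcont : ContinuousAt (fun x => c * ∑ i ∈ s.erase k, -(x - a i)⁻¹ + ψ x) (a k) := by
    refine ContinuousAt.add (continuousAt_const.mul (tendsto_finsetSum _ fun i hi => ?_)) hψ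
    rw [Finset.mem_erase] at hi
    exact ((tendsto_id.sub_const (a i)).inv₀ (sub_ne_zero.2 (hne i hi.2 hi.1))).neg
  refine (hm _ _ _ hlim (hcont.tendsto.mono_left hl)).congr fun x => ?_
  rw [← Finset.add_sum_erase s _ hk]
  ring

theorem exists_eq_zero_sum_neg_inv_sub {ι : Type*} [DecidableEq ι] {s : Finset ι} {a : ι → ℝ}
    {c : ℝ} (hc : 0 < c) {ψ : ℝ → ℝ} {j k : ι} (hj : j ∈ s) (hk : k ∈ s) (hjk : a j < a k)
    (hinj : ∀ i ∈ s, ∀ i' ∈ s, i ≠ i' → a i ≠ a i')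
    (hz : ∀ z ∈ Set.Ioo (a j) (a k), ∀ i ∈ s, z ≠ a i)
    (hψ : ∀ z ∈ Set.Icc (a j) (a k), ContinuousAt ψ z) :
    ∃ z ∈ Set.Ioo (a j) (a k), c * ∑ i ∈ s, -(z - a i)⁻¹ + ψ z = 0 := by
  have hcont : ContinuousOn (fun x => c * ∑ i ∈ s, -(x - a i)⁻¹ + ψ x)
      (Set.Ioo (a j) (a k)) := by
    intro z hzI
    refine ContinuousAt.continuousWithinAt (ContinuousAt.add (continuousAt_const.mul
      (tendsto_finsetSum _ fun i hi => ?_)) (hψ z (Set.Ioo_subset_Icc_self hzI)))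
    exact ((tendsto_id.sub_const (a i)).inv₀ (sub_ne_zero.2 (hz z hzI i hi))).neg
  have hleft : Tendsto (fun x => c * ∑ i ∈ s, -(x - a i)⁻¹ + ψ x)
      (nhdsWithin (a j) (Set.Ioi (a j))) atBot := by
    refine tendsto_sum_neg_inv_sub hj (fun i hi hij => hinj j hj i hi hij.symm)
      (hψ _ (Set.left_mem_Icc.2 hjk.le)) nhdsWithin_le_nhds
      (fun C f g hf hg => hf.atBot_add hg) ?_
    refine Tendsto.const_mul_atBot hc (tendsto_neg_atTop_atBot.comp
      (tendsto_inv_nhdsGT_zero.comp ?_))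
    refine tendsto_nhdsWithin_iff.2 ⟨?_, ?_⟩
    · have : ContinuousAt (fun x => x - a j) (a j) := by fun_prop
      simpa [ContinuousAt] using this.tendsto.mono_left nhdsWithin_le_nhds
    · filter_upwards [self_mem_nhdsWithin] with x hx using sub_pos.2 (Set.mem_Ioi.1 hx)
  have hright : Tendsto (fun x => c * ∑ i ∈ s, -(x - a i)⁻¹ + ψ x)
      (nhdsWithin (a k) (Set.Iio (a k))) atTop := by
    refine tendsto_sum_neg_inv_sub hk (fun i hi hik => hinj k hk i hi hik.symm)
      (hψ _ (Set.right_mem_Icc.2 hjk.le)) nhdsWithin_le_nhds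
      (fun C f g hf hg => hf.atTop_add hg) ?_
    refine Tendsto.const_mul_atTop hc (tendsto_neg_atBot_atTop.comp
      (tendsto_inv_nhdsLT_zero.comp ?_))
    refine tendsto_nhdsWithin_iff.2 ⟨?_, ?_⟩
    · have : ContinuousAt (fun x => x - a k) (a k) := by fun_prop
      simpa [ContinuousAt] using this.tendsto.mono_left nhdsWithin_le_nhds
    · filter_upwards [self_mem_nhdsWithin] with x hx using sub_neg.2 (Set.mem_Iio.1 hx)
  have := nhdsGT_neBot_of_exists_gt ⟨_, hjk⟩
  have := nhdsLT_neBot_of_exists_lt ⟨_, hjk⟩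
  exact isPreconnected_Ioo.intermediate_value_Iii
    (le_principal_iff.2 (Ioo_mem_nhdsGT hjk)) (le_principal_iff.2 (Ioo_mem_nhdsLT hjk))
    hcont hleft hright (Set.mem_univ 0)

theorem exists_pos_mul_sub_le_integral {w : ℝ → ℝ} (hw : ContinuousOn w (Set.Icc (-1 : ℝ) 1))
    (hpos : ∀ t ∈ Set.Icc (-1 : ℝ) 1, 0 < w t) :
    ∃ c > 0, ∀ a b : ℝ, -1 ≤ a → a ≤ b → b ≤ 1 → c * (b - a) ≤ ∫ t in a..b, w t := by
  obtain ⟨t₀, ht₀, hmin⟩ := isCompact_Icc.exists_isMinOn ⟨-1, by norm_num⟩ hw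
  refine ⟨w t₀, hpos t₀ ht₀, fun a b ha hab hb => ?_⟩
  have hsub : Set.Icc a b ⊆ Set.Icc (-1) 1 := Set.Icc_subset_Icc ha hb
  have := intervalIntegral.integral_mono_on (μ := MeasureTheory.volume) hab
    intervalIntegrable_const ((hw.mono hsub).intervalIntegrable_of_Icc hab)
    (fun x hx => hmin (hsub hx))
  simpa [mul_comm] using this

theorem exists_subinterval_mem {K : ℕ} (hK : 0 < K) {z : ℝ} (hz : -1 < z) (hz' : z < 1) :
    ∃ j < K, z ∈ Set.Icc (-1 + 2 * (j : ℝ) / K) (-1 + 2 * ((j : ℝ) + 1) / K) := by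
  have hK' : (0 : ℝ) < K := by exact_mod_cast hK
  have h0 : 0 ≤ (z + 1) * K / 2 := by
    have : 0 < z + 1 := by linarith
    positivity
  refine ⟨⌊(z + 1) * K / 2⌋₊, (Nat.floor_lt h0).2 (by nlinarith), ?_, ?_⟩
  · have h : 2 * (⌊(z + 1) * K / 2⌋₊ : ℝ) / K ≤ z + 1 := by
      rw [div_le_iff₀ hK']
      linarith [Nat.floor_le h0]
    linarith
  · have h : z + 1 ≤ 2 * ((⌊(z + 1) * K / 2⌋₊ : ℝ) + 1) / K := by
      rw [le_div_iff₀ hK']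
      linarith [Nat.lt_floor_add_one ((z + 1) * K / 2)]
    linarith

theorem ObeysDensity.eventually_lt_sum_inv_sq {X : ℕ → ℕ → ℝ} {w : ℝ → ℝ}
    (h : ObeysDensity X w) (hw : ContinuousOn w (Set.Icc (-1 : ℝ) 1))
    (hpos : ∀ t ∈ Set.Icc (-1 : ℝ) 1, 0 < w t) (B : ℝ) :
    ∀ᶠ n : ℕ in atTop, ∀ z ∈ Set.Ioo (-1 : ℝ) 1, (∀ i ∈ Finset.range (n + 1), z ≠ X n i) →
      B < (1 / (n + 1 : ℝ)) * ∑ i ∈ Finset.range (n + 1), ((z - X n i) ^ 2)⁻¹ := by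
  obtain ⟨c, hc, hint⟩ := exists_pos_mul_sub_le_integral hw hpos
  obtain ⟨K, hKB⟩ := exists_nat_gt (max 1 (4 * B / c))
  have hK1 : (1 : ℝ) < K := (le_max_left _ _).trans_lt hKB
  have hK : (0 : ℝ) < K := by linarith
  have hKB' : 4 * B < K * c := (div_lt_iff₀ hc).1 ((le_max_right _ _).trans_lt hKB)
  have hcount : ∀ᶠ n : ℕ in atTop, ∀ j ∈ Finset.range K, c / K <
      (((Finset.range (n + 1)).filter fun i => -1 + 2 * (j : ℝ) / K ≤ X n i ∧
        X n i ≤ -1 + 2 * ((j : ℝ) + 1) / K).card : ℝ) / (n + 1) := by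
    rw [Filter.eventually_all_finset]
    intro j hj
    have hjK : (j : ℝ) + 1 ≤ K := by exact_mod_cast Finset.mem_range.1 hj
    have h1 : -1 ≤ -1 + 2 * (j : ℝ) / K := le_add_of_nonneg_right (by positivity)
    have h2 : -1 + 2 * (j : ℝ) / K ≤ -1 + 2 * ((j : ℝ) + 1) / K := by gcongr; linarith
    have h3 : -1 + 2 * ((j : ℝ) + 1) / K ≤ 1 := by
      have : 2 * ((j : ℝ) + 1) / K ≤ 2 := by rw [div_le_iff₀ hK]; linarith
      linarith
    refine (h _ _ h1 h2 h3).eventually (lt_mem_nhds (lt_of_lt_of_le ?_ (hint _ _ h1 h2 h3)))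
    have : c * (-1 + 2 * ((j : ℝ) + 1) / K - (-1 + 2 * (j : ℝ) / K)) = 2 * (c / K) := by
      field_simp
      ring
    rw [this]
    linarith [div_pos hc hK]
  filter_upwards [hcount] with n hn z hz hne
  obtain ⟨j, hj, hzj⟩ := exists_subinterval_mem (by exact_mod_cast hK) hz.1 hz.2
  have hcard := hn j (Finset.mem_range.2 hj)
  set S := (Finset.range (n + 1)).filter fun i => -1 + 2 * (j : ℝ) / K ≤ X n i ∧
        X n i ≤ -1 + 2 * ((j : ℝ) + 1) / K with hS
  have hlen : -1 + 2 * ((j : ℝ) + 1) / K = -1 + 2 * (j : ℝ) / K + 2 / K := by ring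
  have hsum : (S.card : ℝ) * (K ^ 2 / 4) ≤
      ∑ i ∈ Finset.range (n + 1), ((z - X n i) ^ 2)⁻¹ := by
    calc (S.card : ℝ) * (K ^ 2 / 4) = ∑ _i ∈ S, (K ^ 2 / 4 : ℝ) := by simp
      _ ≤ ∑ i ∈ S, ((z - X n i) ^ 2)⁻¹ := by
        refine Finset.sum_le_sum fun i hi => ?_
        rw [hS, Finset.mem_filter] at hi
        have hd : |z - X n i| ≤ 2 / K := by
          rw [abs_le]
          constructor <;> linarith [hzj.1, hzj.2, hi.2.1, hi.2.2]
        have hsq : (z - X n i) ^ 2 ≤ (2 / K) ^ 2 := by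
          rw [← sq_abs]
          gcongr
        have hp : 0 < (z - X n i) ^ 2 := by
          have := sub_ne_zero.2 (hne i hi.1)
          positivity
        calc (K ^ 2 / 4 : ℝ) = ((2 / K : ℝ) ^ 2)⁻¹ := by field_simp; norm_num
          _ ≤ _ := inv_anti₀ hp hsq
      _ ≤ _ := Finset.sum_le_sum_of_subset_of_nonneg (Finset.filter_subset _ _)
        fun i _ _ => by positivity
  calc B < c / K * (K ^ 2 / 4) := by
        have : c / K * (K ^ 2 / 4 : ℝ) = K * c / 4 := by field_simp
        linarith
    _ ≤ (S.card : ℝ) / (n + 1) * (K ^ 2 / 4) := by gcongr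
    _ = 1 / (n + 1 : ℝ) * ((S.card : ℝ) * (K ^ 2 / 4)) := by ring
    _ ≤ _ := by gcongr

theorem stmt_1 (X : ℕ → ℕ → ℝ) (w : ℝ → ℝ) (φ φ' φ'' : ℕ → ℝ → ℝ) (M : ℝ)
    (hXorder : ∀ n, 1 ≤ n → ∀ i j : ℕ, i < j → j ≤ n → X n i < X n j)
    (hXmem : ∀ n, 1 ≤ n → ∀ i, i ≤ n → X n i ∈ Set.Icc (-1 : ℝ) 1)
    (hw_cont : ContinuousOn w (Set.Icc (-1 : ℝ) 1))
    (hw_pos : ∀ t ∈ Set.Icc (-1 : ℝ) 1, 0 < w t)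
    (hw_int : (∫ t in (-1 : ℝ)..1, w t) = 1)
    (hobeys : ObeysDensity X w)
    (hφd1 : ∀ n, ∀ x ∈ Set.Icc (-1 : ℝ) 1, HasDerivAt (φ n) (φ' n x) x)
    (hφd2 : ∀ n, ∀ x ∈ Set.Icc (-1 : ℝ) 1, HasDerivAt (φ' n) (φ'' n x) x)
    (hφ''cont : ∀ n, ContinuousOn (φ'' n) (Set.Icc (-1 : ℝ) 1))
    (hM : ∀ n, ∀ x ∈ Set.Icc (-1 : ℝ) 1, M ≤ φ'' n x)
    :
    ∃ N : ℕ, ∀ n : ℕ, N ≤ n → ∀ i, 1 ≤ i → i ≤ n →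
      ∃! z : ℝ, z ∈ Set.Ioo (X n (i - 1)) (X n i) ∧
        deriv (discretePotential X φ n) z = 0 := by
  obtain ⟨N, hN⟩ := eventually_atTop.1 (hobeys.eventually_lt_sum_inv_sq hw_cont hw_pos (-M))
  refine ⟨max N 1, fun n hn i hi hin => ?_⟩
  have hn1 : 1 ≤ n := (le_max_right _ _).trans hn
  have hlt : X n (i - 1) < X n i := hXorder n hn1 _ _ (by omega) hin
  have hleft := (hXmem n hn1 (i - 1) (by omega)).1
  have hright := (hXmem n hn1 i hin).2
  have hIcc : Set.Icc (X n (i - 1)) (X n i) ⊆ Set.Icc (-1) 1 := Set.Icc_subset_Icc hleft hright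
  have hIoo : Set.Ioo (X n (i - 1)) (X n i) ⊆ Set.Ioo (-1) 1 := Set.Ioo_subset_Ioo hleft hright
  have hinj : ∀ j ∈ Finset.range (n + 1), ∀ k ∈ Finset.range (n + 1), j ≠ k →
      X n j ≠ X n k := by
    intro j hj k hk hjk
    rw [Finset.mem_range] at hj hk
    rcases lt_or_gt_of_ne hjk with h | h
    · exact (hXorder n hn1 _ _ h (by omega)).ne
    · exact (hXorder n hn1 _ _ h (by omega)).ne'
  have hne : ∀ z ∈ Set.Ioo (X n (i - 1)) (X n i), ∀ j ∈ Finset.range (n + 1), z ≠ X n j := by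
    rintro z hz j hj rfl
    rw [Finset.mem_range] at hj
    rcases lt_trichotomy j (i - 1) with h | rfl | h
    · exact lt_asymm hz.1 (hXorder n hn1 _ _ h (by omega))
    · exact lt_irrefl _ hz.1
    · rcases (show i ≤ j by omega).eq_or_lt with rfl | h
      · exact lt_irrefl _ hz.2
      · exact lt_asymm hz.2 (hXorder n hn1 _ _ h (by omega))
  have hderiv : ∀ z ∈ Set.Ioo (X n (i - 1)) (X n i), deriv (discretePotential X φ n) z =
      (1 / (n + 1 : ℝ)) * ∑ j ∈ Finset.range (n + 1), -(z - X n j)⁻¹ + φ' n z := fun z hz =>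
    (hasDerivAt_discretePotential (hne z hz)
      (hφd1 n z (hIcc (Set.Ioo_subset_Icc_self hz)))).deriv
  have hderiv2 := fun z (hz : z ∈ Set.Ioo (X n (i - 1)) (X n i)) =>
    hasDerivAt_sum_neg_inv_sub (Finset.range (n + 1)) (X n) (1 / (n + 1 : ℝ)) (hne z hz)
      (hφd2 n z (hIcc (Set.Ioo_subset_Icc_self hz)))
  have hmono : StrictMonoOn (fun z =>
      (1 / (n + 1 : ℝ)) * ∑ j ∈ Finset.range (n + 1), -(z - X n j)⁻¹ + φ' n z)
      (Set.Ioo (X n (i - 1)) (X n i)) := by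
    refine strictMonoOn_of_deriv_pos (convex_Ioo _ _)
      (fun z hz => (hderiv2 z hz).continuousAt.continuousWithinAt) fun z hz => ?_
    rw [interior_Ioo] at hz
    rw [(hderiv2 z hz).deriv]
    linarith [hN n ((le_max_left _ _).trans hn) z (hIoo hz) (hne z hz),
      hM n z (hIcc (Set.Ioo_subset_Icc_self hz))]
  obtain ⟨z, hz, hz0⟩ := exists_eq_zero_sum_neg_inv_sub
    (show (0 : ℝ) < 1 / (n + 1 : ℝ) by positivity) (Finset.mem_range.2 (by omega))
    (Finset.mem_range.2 (by omega)) hlt hinj hne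
    (fun z hz => (hφd2 n z (hIcc hz)).continuousAt)
  refine ⟨z, ⟨hz, (hderiv z hz).trans hz0⟩, fun y hy => hmono.injOn hy.1 hz ?_⟩
  exact ((hderiv y hy.1).symm.trans hy.2).trans hz0.symm
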